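/- Let X = MD(G, S0, S1, T0, T1) be a strongly connected mixed Cayley digraph. Suppose there exist a proper subgroup H of G with |H| < δ(X), an element s0 ∈ S0 with ⟨(S0 ∪ {1_G}) \ {s0}⟩ ≤ H, and an element t0 ∈ T0 with ⟨S1⟩ ≤ t0·H·t0⁻¹, T1⁻¹·t0 ⊆ H, and t0⁻¹·T0 ⊆ H. Then the set A = (H × {0}) ∪ ((t0·H) × {1}) satisfies |ω⁺(A)| = |H| < δ(X); in particular λ(X) < δ(X). -/

import Mathlib

open Set Pointwise

/-- Arc relation of the mixed Cayley digraph `MD(G,S0,S1,T0,T1)` on vertex set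
`G × Bool`, where `false` plays the role of the index `0` and `true` of `1`. -/
def MDArc {G : Type*} [Group G] (S0 S1 T0 T1 : Set G) (u v : G × Bool) : Prop :=
  (u.2 = false ∧ v.2 = false ∧ ∃ s ∈ S0, v.1 = s * u.1) ∨
  (u.2 = true ∧ v.2 = true ∧ ∃ s ∈ S1, v.1 = s * u.1) ∨
  (u.2 = false ∧ v.2 = true ∧ ∃ t ∈ T0, v.1 = t * u.1) ∨
  (u.2 = true ∧ v.2 = false ∧ ∃ t ∈ T1, u.1 = t * v.1)

/-- A digraph (given by its arc relation) is strongly connected if every vertex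
is reachable from every other vertex by a directed path. -/
def DigraphStronglyConnected {V : Type*} (R : V → V → Prop) : Prop :=
  ∀ u v : V, Relation.ReflTransGen R u v

/-- Out-degree of a vertex: the number of arcs originating at it. -/
noncomputable def outDegree {V : Type*} (R : V → V → Prop) (v : V) : ℕ :=
  {w | R v w}.ncard

/-- In-degree of a vertex: the number of arcs terminating at it. -/
noncomputable def inDegree {V : Type*} (R : V → V → Prop) (v : V) : ℕ :=
  {w | R w v}.ncard

/-- `δ`: the minimum, over all vertices, of in-degrees and out-degrees. -/
noncomputable def minDegree {V : Type*} (R : V → V → Prop) : ℕ :=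
  sInf {n | ∃ v, n = outDegree R v ∨ n = inDegree R v}

/-- `W` is an arc-disconnecting set: a set of arcs whose deletion leaves a
digraph that is not strongly connected. -/
def IsDisconnectingArcSet {V : Type*} (R : V → V → Prop) (W : Set (V × V)) : Prop :=
  (∀ p ∈ W, R p.1 p.2) ∧
  ¬ DigraphStronglyConnected (fun u v => R u v ∧ (u, v) ∉ W)

/-- The arc connectivity `λ`: the minimum cardinality of an arc-disconnecting set. -/
noncomputable def arcConnectivity {V : Type*} (R : V → V → Prop) : ℕ :=
  sInf {n | ∃ W : Set (V × V), IsDisconnectingArcSet R W ∧ W.ncard = n}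

/-- `ω⁺(A)`: the set of arcs from `A` to its complement. -/
def omegaPlus {V : Type*} (R : V → V → Prop) (A : Set V) : Set (V × V) :=
  {p | R p.1 p.2 ∧ p.1 ∈ A ∧ p.2 ∉ A}

/-- `ω⁻(A)`: the set of arcs from the complement of `A` to `A`. -/
def omegaMinus {V : Type*} (R : V → V → Prop) (A : Set V) : Set (V × V) :=
  {p | R p.1 p.2 ∧ p.1 ∉ A ∧ p.2 ∈ A}

/-- A positive arc fragment: a proper nonempty vertex subset with `|ω⁺(A)| = λ`. -/
def IsPosFragment {V : Type*} (R : V → V → Prop) (A : Set V) : Prop :=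
  A.Nonempty ∧ A ≠ Set.univ ∧ (omegaPlus R A).ncard = arcConnectivity R

/-- A negative arc fragment: a proper nonempty vertex subset with `|ω⁻(A)| = λ`. -/
def IsNegFragment {V : Type*} (R : V → V → Prop) (A : Set V) : Prop :=
  A.Nonempty ∧ A ≠ Set.univ ∧ (omegaMinus R A).ncard = arcConnectivity R

/-- An arc fragment: a positive or negative arc fragment. -/
def IsArcFragment {V : Type*} (R : V → V → Prop) (A : Set V) : Prop :=
  IsPosFragment R A ∨ IsNegFragment R A

/-- A `λ`-atom: an arc fragment of least possible cardinality. -/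
def IsLambdaAtom {V : Type*} (R : V → V → Prop) (A : Set V) : Prop :=
  IsArcFragment R A ∧ ∀ B, IsArcFragment R B → A.ncard ≤ B.ncard

/-- A positive `λ`-atom: a positive arc fragment of least possible cardinality
among all arc fragments. -/
def IsPosLambdaAtom {V : Type*} (R : V → V → Prop) (A : Set V) : Prop :=
  IsPosFragment R A ∧ ∀ B, IsArcFragment R B → A.ncard ≤ B.ncard

/-- A negative `λ`-atom: a negative arc fragment of least possible cardinality
among all arc fragments. -/
def IsNegLambdaAtom {V : Type*} (R : V → V → Prop) (A : Set V) : Prop :=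
  IsNegFragment R A ∧ ∀ B, IsArcFragment R B → A.ncard ≤ B.ncard

/-- A `λ`-superatom: an arc fragment with at least two vertices, of least
possible cardinality among arc fragments with at least two vertices. -/
def IsLambdaSuperatom {V : Type*} (R : V → V → Prop) (A : Set V) : Prop :=
  IsArcFragment R A ∧ 2 ≤ A.ncard ∧
    ∀ B, IsArcFragment R B → 2 ≤ B.ncard → A.ncard ≤ B.ncard

/-- A positive `λ`-superatom. -/
def IsPosLambdaSuperatom {V : Type*} (R : V → V → Prop) (A : Set V) : Prop :=
  IsPosFragment R A ∧ 2 ≤ A.ncard ∧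
    ∀ B, IsArcFragment R B → 2 ≤ B.ncard → A.ncard ≤ B.ncard

/-- A negative `λ`-superatom. -/
def IsNegLambdaSuperatom {V : Type*} (R : V → V → Prop) (A : Set V) : Prop :=
  IsNegFragment R A ∧ 2 ≤ A.ncard ∧
    ∀ B, IsArcFragment R B → 2 ≤ B.ncard → A.ncard ≤ B.ncard

/-- The set of out-arcs of a vertex. -/
def outArcsOf {V : Type*} (R : V → V → Prop) (v : V) : Set (V × V) :=
  {p | R p.1 p.2 ∧ p.1 = v}

/-- The set of in-arcs of a vertex. -/
def inArcsOf {V : Type*} (R : V → V → Prop) (v : V) : Set (V × V) :=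
  {p | R p.1 p.2 ∧ p.2 = v}

/-- A digraph is super-`λ` if every minimum arc-disconnecting set is the set of
in-arcs of some vertex or the set of out-arcs of some vertex. -/
def SuperLambda {V : Type*} (R : V → V → Prop) : Prop :=
  ∀ W : Set (V × V), IsDisconnectingArcSet R W → W.ncard = arcConnectivity R →
    (∃ v, W = outArcsOf R v) ∨ (∃ v, W = inArcsOf R v)

/-- Deleting the arcs leaving a nonempty proper vertex subset destroys strong connectivity. -/
theorem isDisconnectingArcSet_omegaPlus {V : Type*} (R : V → V → Prop) {A : Set V}
    (hA : A.Nonempty) (hA' : A ≠ Set.univ) : IsDisconnectingArcSet R (omegaPlus R A) := by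
  refine ⟨fun p hp => hp.1, fun hconn => ?_⟩
  obtain ⟨a, ha⟩ := hA
  obtain ⟨b, hb⟩ := (Set.ne_univ_iff_exists_notMem A).1 hA'
  suffices h : ∀ c, Relation.ReflTransGen (fun u v => R u v ∧ (u, v) ∉ omegaPlus R A) a c → c ∈ A
    from hb (h b (hconn a b))
  intro c hc
  induction hc with
  | refl => exact ha
  | tail _ huv hu =>
    by_contra hv
    exact huv.2 ⟨huv.1, hu, hv⟩

/-- In a strongly connected digraph some arc leaves every nonempty proper vertex subset. -/
theorem DigraphStronglyConnected.omegaPlus_nonempty {V : Type*} {R : V → V → Prop}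
    (hR : DigraphStronglyConnected R) {A : Set V} (hA : A.Nonempty) (hA' : A ≠ Set.univ) :
    (omegaPlus R A).Nonempty := by
  by_contra h
  have hdis := (isDisconnectingArcSet_omegaPlus R hA hA').2
  rw [Set.not_nonempty_iff_eq_empty.1 h] at hdis
  exact hdis (by simpa using hR)

/-- The arc-connectivity is at most the number of arcs leaving a nonempty proper vertex subset. -/
theorem arcConnectivity_le_ncard_omegaPlus {V : Type*} (R : V → V → Prop) {A : Set V}
    (hA : A.Nonempty) (hA' : A ≠ Set.univ) : arcConnectivity R ≤ (omegaPlus R A).ncard :=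
  Nat.sInf_le ⟨_, isDisconnectingArcSet_omegaPlus R hA hA', rfl⟩

/-- under Condition 1, the set `A = H×{0} ∪ (t0·H)×{1}` has
`|ω⁺(A)| = |H| < δ(X)`; in particular `λ(X) < δ(X)`. -/
theorem mixedCayley_condition1_witness
    {G : Type*} [Group G] [Fintype G] (S0 S1 T0 T1 : Set G)
    (hS0 : (1 : G) ∉ S0) (hS1 : (1 : G) ∉ S1)
    (hT0 : T0.Nonempty) (hT1 : T1.Nonempty)
    (hsc : DigraphStronglyConnected (MDArc S0 S1 T0 T1))
    (H : Subgroup G) (hH : H ≠ ⊤)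
    (hcard : Nat.card H < minDegree (MDArc S0 S1 T0 T1))
    (s0 : G) (hs0 : s0 ∈ S0)
    (hgen : Subgroup.closure ((S0 ∪ {1}) \ {s0}) ≤ H)
    (t0 : G) (ht0 : t0 ∈ T0)
    (hS1H : (Subgroup.closure S1 : Set G) ⊆ {t0} * (H : Set G) * {t0}⁻¹)
    (hT1H : T1⁻¹ * {t0} ⊆ (H : Set G))
    (hT0H : {t0}⁻¹ * T0 ⊆ (H : Set G)) :
    (omegaPlus (MDArc S0 S1 T0 T1)
        (((H : Set G) ×ˢ ({false} : Set Bool)) ∪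
          (({t0} * (H : Set G)) ×ˢ ({true} : Set Bool)))).ncard = Nat.card H ∧
    arcConnectivity (MDArc S0 S1 T0 T1) < minDegree (MDArc S0 S1 T0 T1) := by
  set A : Set (G × Bool) := ((H : Set G) ×ˢ ({false} : Set Bool)) ∪
    (({t0} * (H : Set G)) ×ˢ ({true} : Set Bool)) with hAdef
  have mem_false (g : G) : (g, false) ∈ A ↔ g ∈ H := by simp [hAdef]
  have mem_true (g : G) : (g, true) ∈ A ↔ t0⁻¹ * g ∈ H := by
    simp [hAdef, Set.singleton_mul]
  have hA : A.Nonempty := ⟨(1, false), (mem_false 1).2 H.one_mem⟩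
  have hA' : A ≠ Set.univ := fun h =>
    hH ((Subgroup.eq_top_iff' H).2 fun g => (mem_false g).1 (h ▸ Set.mem_univ _))
  have S0_mem (s : G) (hs : s ∈ S0) (hne : s ≠ s0) : s ∈ H :=
    hgen (Subgroup.subset_closure ⟨Or.inl hs, hne⟩)
  have S1_mem (s : G) (hs : s ∈ S1) : t0⁻¹ * s * t0 ∈ H := by
    rw [Set.inv_singleton] at hS1H
    obtain ⟨_, ⟨_, rfl, h, hh, rfl⟩, _, rfl, rfl⟩ := hS1H (Subgroup.subset_closure hs)
    simpa [mul_assoc] using hh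
  have T0_mem (t : G) (ht : t ∈ T0) : t0⁻¹ * t ∈ H :=
    hT0H (Set.mul_mem_mul (Set.inv_mem_inv.2 rfl) ht)
  have T1_mem (t : G) (ht : t ∈ T1) : t⁻¹ * t0 ∈ H :=
    hT1H (Set.mul_mem_mul (Set.inv_mem_inv.2 ht) rfl)
  have leaving {p : (G × Bool) × (G × Bool)} (hp : p ∈ omegaPlus (MDArc S0 S1 T0 T1) A) :
      ∃ h ∈ H, s0 * h ∉ H ∧ p = ((h, false), (s0 * h, false)) := by
    obtain ⟨⟨u, i⟩, v, j⟩ := p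
    obtain ⟨harc, hu, hv⟩ := hp
    rcases harc with ⟨hi, hj, s, hs, e⟩ | ⟨hi, hj, s, hs, e⟩ | ⟨hi, hj, t, ht, e⟩ |
      ⟨hi, hj, t, ht, e⟩ <;> dsimp only at hi hj e hu hv <;> subst hi hj e
    · rw [mem_false] at hu hv
      obtain rfl : s = s0 := by
        by_contra hne
        exact hv (H.mul_mem (S0_mem s hs hne) hu)
      exact ⟨u, hu, hv, rfl⟩
    · rw [mem_true] at hu hv
      exact absurd (by simpa [mul_assoc] using H.mul_mem (S1_mem s hs) hu) hv
    · rw [mem_false] at hu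
      rw [mem_true] at hv
      exact absurd (by simpa [mul_assoc] using H.mul_mem (T0_mem t ht) hu) hv
    · rw [mem_true] at hu
      rw [mem_false] at hv
      exact absurd (by simpa [mul_assoc] using H.mul_mem (T1_mem t ht) hu) hv
  have hs0H : s0 ∉ H := by
    obtain ⟨p, hp⟩ := hsc.omegaPlus_nonempty hA hA'
    obtain ⟨h, hh, hs, -⟩ := leaving hp
    exact fun hmem => hs (H.mul_mem hmem hh)
  have hω : omegaPlus (MDArc S0 S1 T0 T1) A =
      (fun h : G => ((h, false), (s0 * h, false))) '' (H : Set G) := by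
    ext p
    constructor
    · intro hp
      obtain ⟨h, hh, -, rfl⟩ := leaving hp
      exact ⟨h, hh, rfl⟩
    · rintro ⟨h, hh, rfl⟩
      refine ⟨Or.inl ⟨rfl, rfl, s0, hs0, rfl⟩, (mem_false h).2 hh, fun hmem => hs0H ?_⟩
      exact (H.mul_mem_cancel_right hh).1 ((mem_false _).1 hmem)
  have hncard : (omegaPlus (MDArc S0 S1 T0 T1) A).ncard = Nat.card H := by
    rw [hω, Set.ncard_image_of_injective _ fun a b hab => by simpa using congrArg (·.1.1) hab]
    rfl
  exact ⟨hncard, (arcConnectivity_le_ncard_omegaPlus _ hA hA').trans_lt (hncard ▸ hcard)⟩
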